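/- Let i, j ∈ [n] and m ∈ ℕ be such that 2m ≥ n − j + 2. Then [t_i, t_j]^m = 0 in k[S_n]. -/

import Mathlib

/-- The simple transposition `s_i ∈ S_n` (1-based indexing), swapping `i` and `i+1`,
defined as the identity for `i` outside `{1, …, n-1}`. -/
def simpleTransposition (n i : ℕ) : Equiv.Perm (Fin n) :=
  if h : 1 ≤ i ∧ i < n then
    Equiv.swap ⟨i - 1, by omega⟩ ⟨i, h.2⟩
  else 1

/-- The cycle `(v ⟹ w) = s_v s_{v+1} ⋯ s_{w-1} ∈ S_n`, sending
`v ↦ v+1 ↦ ⋯ ↦ w ↦ v` (and equal to the identity when `v = w`). -/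
def cyc (n v w : ℕ) : Equiv.Perm (Fin n) :=
  ((List.range' v (w - v)).map (simpleTransposition n)).prod

/-- The somewhere-to-below shuffle `t_ℓ = Σ_{w=ℓ}^{n} (ℓ ⟹ w)` in the group
algebra `R[S_n]`. -/
noncomputable def t (R : Type*) [CommRing R] (n ℓ : ℕ) :
    MonoidAlgebra R (Equiv.Perm (Fin n)) :=
  ∑ w ∈ Finset.Icc ℓ n, MonoidAlgebra.of R (Equiv.Perm (Fin n)) (cyc n ℓ w)

/-- The simple transposition `s_i` as an element of the group algebra. -/
noncomputable abbrev simpleElement (R : Type*) [CommRing R] (n i : ℕ) :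
    MonoidAlgebra R (Equiv.Perm (Fin n)) :=
  MonoidAlgebra.of R (Equiv.Perm (Fin n)) (simpleTransposition n i)

/-- The product `t_{j+k-1} ⋯ t_{j+1} t_j` of `k` consecutive somewhere-to-below shuffles. -/
noncomputable def shuffleProd (R : Type*) [CommRing R] (n : ℕ) :
    ℕ → ℕ → MonoidAlgebra R (Equiv.Perm (Fin n))
  | _, 0 => 1
  | j, k + 1 => shuffleProd R n (j + 1) k * t R n j

theorem simpleTransposition_mul_self (n i : ℕ) :
    simpleTransposition n i * simpleTransposition n i = 1 := by
  unfold simpleTransposition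
  split_ifs <;> simp

theorem simpleTransposition_commute (n : ℕ) {u v : ℕ} (h : u + 2 ≤ v) :
    Commute (simpleTransposition n u) (simpleTransposition n v) := by
  unfold simpleTransposition
  split_ifs
  · apply Equiv.Perm.Disjoint.commute
    apply Equiv.Perm.disjoint_swap_swap
    simp [Fin.ext_iff]
    omega
  all_goals simp

theorem simpleTransposition_braid {n i : ℕ} (hi : 1 ≤ i) (hin : i + 1 < n) :
    simpleTransposition n i * simpleTransposition n (i + 1) * simpleTransposition n i =
      simpleTransposition n (i + 1) * simpleTransposition n i *
        simpleTransposition n (i + 1) := by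
  have h₁ : 1 ≤ i ∧ i < n := by omega
  have h₂ : 1 ≤ i + 1 ∧ i + 1 < n := by omega
  simp only [simpleTransposition, dif_pos h₁, dif_pos h₂, Nat.add_sub_cancel]
  rw [Equiv.swap_mul_swap_mul_swap, Equiv.swap_comm (⟨i, _⟩ : Fin n) ⟨i + 1, _⟩,
    Equiv.swap_comm (⟨i - 1, _⟩ : Fin n) ⟨i, _⟩, Equiv.swap_mul_swap_mul_swap,
    Equiv.swap_comm]
  all_goals simp [Fin.ext_iff]
  all_goals omega

theorem cyc_self (n v : ℕ) : cyc n v v = 1 := by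
  simp [cyc]

theorem cyc_eq_mul {n v w : ℕ} (h : v < w) :
    cyc n v w = simpleTransposition n v * cyc n (v + 1) w := by
  have hw : w - v = (w - (v + 1)) + 1 := by omega
  simp [cyc, hw, List.range'_succ]

theorem commute_cyc (n : ℕ) {v ℓ : ℕ} (h : v + 2 ≤ ℓ) (w : ℕ) :
    Commute (simpleTransposition n v) (cyc n ℓ w) := by
  refine Commute.list_prod_right _ _ fun x hx => ?_
  obtain ⟨u, hu, rfl⟩ := List.mem_map.1 hx
  exact simpleTransposition_commute n (h.trans (List.mem_range'_1.1 hu).1)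

section

variable (R : Type*) [CommRing R]

theorem simpleElement_mul_self (n i : ℕ) : simpleElement R n i * simpleElement R n i = 1 := by
  rw [← map_mul, simpleTransposition_mul_self, map_one]

theorem simpleElement_braid {n i : ℕ} (hi : 1 ≤ i) (hin : i + 1 < n) :
    simpleElement R n i * simpleElement R n (i + 1) * simpleElement R n i =
      simpleElement R n (i + 1) * simpleElement R n i * simpleElement R n (i + 1) := by
  simp only [← map_mul, simpleTransposition_braid hi hin]

theorem t_eq_zero {n ℓ : ℕ} (h : n < ℓ) : t R n ℓ = 0 := by
  simp [t, Finset.Icc_eq_empty_of_lt h]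

theorem t_eq_one_add {n ℓ : ℕ} (h : ℓ ≤ n) :
    t R n ℓ = 1 + simpleElement R n ℓ * t R n (ℓ + 1) := by
  rw [t, ← Finset.add_sum_Ioc_eq_sum_Icc h, cyc_self, map_one, t, Finset.mul_sum]
  congr 1
  have : Finset.Ioc ℓ n = Finset.Icc (ℓ + 1) n := by ext; simp
  rw [this]
  refine Finset.sum_congr rfl fun w hw => ?_
  rw [← map_mul, cyc_eq_mul (Finset.mem_Icc.1 hw).1]

theorem simpleElement_commute_t (n : ℕ) {v ℓ : ℕ} (h : v + 2 ≤ ℓ) :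
    Commute (simpleElement R n v) (t R n ℓ) :=
  Commute.sum_right _ _ _ fun w _ =>
    (commute_cyc n h w).map (MonoidAlgebra.of R (Equiv.Perm (Fin n)))

theorem commute_shuffleProd {n a : ℕ} {x : MonoidAlgebra R (Equiv.Perm (Fin n))}
    (hx : ∀ ℓ, a ≤ ℓ → Commute x (t R n ℓ)) (k : ℕ) {b : ℕ} (hb : a ≤ b) :
    Commute x (shuffleProd R n b k) := by
  induction k generalizing b with
  | zero => exact Commute.one_right x
  | succ k ih => exact (ih (by omega)).mul_right (hx b hb)

theorem shuffleProd_eq_zero {n j k : ℕ} (hj : j ≤ n) (h : n + 1 < j + k) :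
    shuffleProd R n j k = 0 := by
  induction k generalizing j with
  | zero => omega
  | succ k ih =>
    rw [shuffleProd]
    rcases hj.lt_or_eq with hlt | rfl
    · rw [ih hlt (by omega), zero_mul]
    · cases k with
      | zero => omega
      | succ k => rw [shuffleProd, t_eq_zero R (Nat.lt_succ_self _), mul_zero, zero_mul]

/-- The product `t_{j+1} t_j` is invariant under left multiplication by `s_j`. -/
theorem simpleElement_mul_t_succ_mul_t {n j : ℕ} (hj : 1 ≤ j) (hjn : j ≤ n) :
    simpleElement R n j * (t R n (j + 1) * t R n j) = t R n (j + 1) * t R n j := by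
  induction hjn using Nat.decreasingInduction with
  | self => simp [t_eq_zero R (Nat.lt_succ_self n)]
  | of_succ j hlt ih =>
    have ih := ih (by omega)
    have hs := simpleElement_mul_self R n j
    have hcomm := (simpleElement_commute_t R n (v := j) (ℓ := j + 2) le_rfl).eq
    set a := simpleElement R n j
    set b := simpleElement R n (j + 1)
    have hexp : t R n (j + 1) * t R n j =
        t R n (j + 1) + a * t R n (j + 1) + b * a * (t R n (j + 2) * t R n (j + 1)) := by
      have h₁ : t R n j = 1 + a * t R n (j + 1) := t_eq_one_add R hlt.le
      have h₂ : t R n (j + 1) = 1 + b * t R n (j + 2) := t_eq_one_add R hlt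
      calc t R n (j + 1) * t R n j
          = t R n (j + 1) + t R n (j + 1) * a * t R n (j + 1) := by rw [h₁]; noncomm_ring
        _ = t R n (j + 1) + (1 + b * t R n (j + 2)) * a * t R n (j + 1) := by rw [← h₂]
        _ = t R n (j + 1) + a * t R n (j + 1)
              + b * (t R n (j + 2) * a) * t R n (j + 1) := by noncomm_ring
        _ = _ := by rw [← hcomm]; noncomm_ring
    have hinv : a * (b * a * (t R n (j + 2) * t R n (j + 1))) =
        b * a * (t R n (j + 2) * t R n (j + 1)) := by
      by_cases hn : j + 1 < n
      · have hbraid : a * b * a = b * a * b := simpleElement_braid R hj hn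
        rw [← mul_assoc, ← mul_assoc a, hbraid, mul_assoc (b * a), ih]
      · simp [t_eq_zero R (show n < j + 2 by omega)]
    rw [hexp, mul_add, mul_add, hinv, ← mul_assoc, hs, one_mul,
      add_comm (a * t R n (j + 1))]

theorem exists_t_eq_add_mul {n i j : ℕ} (hij : i ≤ j) (hjn : j ≤ n) :
    ∃ r c, Commute r (t R n j) ∧ (∀ ℓ, j + 1 ≤ ℓ → Commute c (t R n ℓ)) ∧
      t R n i = r + c * t R n j := by
  suffices h : ∃ r c, Commute r (t R n j) ∧ (∀ ℓ, j + 1 ≤ ℓ → Commute c (t R n ℓ)) ∧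
      t R n i = r + c * t R n j ∧ (i = j → r = 0) by
    obtain ⟨r, c, hr, hc, h, -⟩ := h
    exact ⟨r, c, hr, hc, h⟩
  induction hij using Nat.decreasingInduction with
  | self => exact ⟨0, 1, Commute.zero_left _, fun _ _ => Commute.one_left _, by simp, by simp⟩
  | of_succ i hlt ih =>
    obtain ⟨r, c, hr, hc, h, h₀⟩ := ih
    refine ⟨1 + simpleElement R n i * r, simpleElement R n i * c, ?_, fun ℓ hℓ => ?_, ?_, by omega⟩
    · refine (Commute.one_left _).add_left ?_
      by_cases hi : i + 1 = j
      · simp [h₀ hi]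
      · exact (simpleElement_commute_t R n (by omega)).mul_left hr
    · exact (simpleElement_commute_t R n (by omega)).mul_left (hc ℓ hℓ)
    · rw [t_eq_one_add R (by omega : i ≤ n), h]
      noncomm_ring

theorem exists_commutator_eq {n i j : ℕ} (hij : i ≤ j) (hj : 1 ≤ j) (hjn : j ≤ n) :
    ∃ c, (∀ ℓ, j + 1 ≤ ℓ → Commute c (t R n ℓ)) ∧
      t R n i * t R n j - t R n j * t R n i =
        (1 - simpleElement R n j) * c * (t R n (j + 1) * t R n j) := by
  obtain ⟨r, c, hr, hc, h⟩ := exists_t_eq_add_mul R hij hjn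
  refine ⟨c, hc, ?_⟩
  have hsq : t R n j * t R n j = t R n j + t R n (j + 1) * t R n j := by
    nth_rw 1 [t_eq_one_add R hjn]
    rw [add_mul, one_mul, mul_assoc, simpleElement_mul_t_succ_mul_t R hj hjn]
  have hc' := (hc _ le_rfl).eq
  calc t R n i * t R n j - t R n j * t R n i
      = (r * t R n j - t R n j * r) + c * (t R n j * t R n j) - t R n j * c * t R n j := by
        rw [h]; noncomm_ring
    _ = c * t R n j + (c * t R n (j + 1)) * t R n j
          - (1 + simpleElement R n j * t R n (j + 1)) * c * t R n j := by
        rw [hr.eq, sub_self, hsq, ← t_eq_one_add R hjn]; noncomm_ring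
    _ = (c * t R n (j + 1)) * t R n j
          - simpleElement R n j * (t R n (j + 1) * c) * t R n j := by noncomm_ring
    _ = _ := by rw [← hc']; noncomm_ring

theorem exists_shuffleProd_mul_one_sub {n j : ℕ} (k : ℕ) (hj : 1 ≤ j) :
    ∃ y, shuffleProd R n j k * (1 - simpleElement R n j) =
      y * (1 - simpleElement R n j) * shuffleProd R n (j + 2) k := by
  induction k generalizing j with
  | zero => exact ⟨1, by simp [shuffleProd]⟩
  | succ k ih =>
    by_cases hn : j + 1 < n
    · obtain ⟨y, hy⟩ := ih (j := j + 1) (by omega)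
      have hs := simpleElement_mul_self R n j
      have hbraid := simpleElement_braid R hj hn
      have ht₁ := t_eq_one_add R (n := n) (ℓ := j) (by omega)
      have ht₂ := t_eq_one_add R (n := n) (ℓ := j + 1) (by omega)
      have hcomm := (simpleElement_commute_t R n (v := j) (ℓ := j + 2) le_rfl).eq
      have hcommProd : Commute (simpleElement R n j * simpleElement R n (j + 1))
          (shuffleProd R n (j + 3) k) :=
        commute_shuffleProd R (fun ℓ hℓ => (simpleElement_commute_t R n (by omega)).mul_left
          (simpleElement_commute_t R n (by omega))) k le_rfl
      refine ⟨y * (simpleElement R n j * simpleElement R n (j + 1)), ?_⟩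
      rw [shuffleProd, shuffleProd]
      set a := simpleElement R n j
      set b := simpleElement R n (j + 1)
      have hab : (1 - b) * (a * b) = a * b * (1 - a) := by
        rw [sub_mul, mul_sub, one_mul, mul_one, hbraid, mul_assoc]
      have ht : t R n j * (1 - a) = (1 - b) * (a * b) * t R n (j + 2) := by
        calc t R n j * (1 - a)
            = (1 - a * a) + a * b * (t R n (j + 2) - t R n (j + 2) * a) := by
              rw [ht₁, ht₂]; noncomm_ring
          _ = a * b * (1 - a) * t R n (j + 2) := by
              rw [hs, ← hcomm]; noncomm_ring
          _ = _ := by rw [hab]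
      calc shuffleProd R n (j + 1) k * t R n j * (1 - a)
          = (shuffleProd R n (j + 1) k * (1 - b)) * (a * b) * t R n (j + 2) := by
            rw [mul_assoc, ht]; noncomm_ring
        _ = y * (1 - b) * (shuffleProd R n (j + 3) k * (a * b)) * t R n (j + 2) := by
            rw [hy]; noncomm_ring
        _ = y * ((1 - b) * (a * b)) * (shuffleProd R n (j + 3) k * t R n (j + 2)) := by
            rw [← hcommProd.eq]; noncomm_ring
        _ = _ := by rw [hab]; noncomm_ring
    · refine ⟨0, ?_⟩
      rw [zero_mul, zero_mul, shuffleProd, mul_assoc]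
      suffices h : t R n j * (1 - simpleElement R n j) = 0 by rw [h, mul_zero]
      rcases lt_trichotomy n j with h | rfl | h
      · rw [t_eq_zero R h, zero_mul]
      · have h : simpleElement R n n = 1 := by
          simp [simpleElement, simpleTransposition, MonoidAlgebra.one_def]
        rw [h, sub_self, mul_zero]
      · rw [t_eq_one_add R h.le, t_eq_one_add R (show j + 1 ≤ n from h),
          t_eq_zero R (show n < j + 1 + 1 by omega), mul_zero, add_zero, mul_one, add_mul,
          mul_sub (simpleElement R n j), simpleElement_mul_self]
        noncomm_ring

theorem exists_commutator_pow_eq {n i j : ℕ} (hij : i ≤ j) (hj : 1 ≤ j) (hjn : j ≤ n) (m : ℕ) :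
    ∃ y, (t R n i * t R n j - t R n j * t R n i) ^ m = y * shuffleProd R n j (2 * m) := by
  obtain ⟨c, hc, hD⟩ := exists_commutator_eq R hij hj hjn
  induction m with
  | zero => exact ⟨1, by simp [shuffleProd]⟩
  | succ m ih =>
    obtain ⟨y, hy⟩ := ih
    obtain ⟨z, hz⟩ := exists_shuffleProd_mul_one_sub R (n := n) (2 * m) hj
    have hcomm := commute_shuffleProd R hc (2 * m) (Nat.le_succ (j + 1))
    refine ⟨y * z * (1 - simpleElement R n j) * c, ?_⟩
    rw [pow_succ, hy, hD, show 2 * (m + 1) = 2 * m + 1 + 1 by ring, shuffleProd, shuffleProd]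
    calc _ = y * (shuffleProd R n j (2 * m) * (1 - simpleElement R n j)) * c *
          (t R n (j + 1) * t R n j) := by simp only [mul_assoc]
      _ = y * z * (1 - simpleElement R n j) * (shuffleProd R n (j + 2) (2 * m) * c) *
          (t R n (j + 1) * t R n j) := by rw [hz]; simp only [mul_assoc]
      _ = _ := by rw [← hcomm.eq]; simp only [mul_assoc]

theorem commutator_pow_eq_zero {n i j m : ℕ} (hij : i ≤ j) (hj : 1 ≤ j) (hjn : j ≤ n)
    (hm : n - j + 2 ≤ 2 * m) : (t R n i * t R n j - t R n j * t R n i) ^ m = 0 := by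
  obtain ⟨y, hy⟩ := exists_commutator_pow_eq R hij hj hjn m
  rw [hy, shuffleProd_eq_zero R hjn (by omega), mul_zero]

end

theorem somewhere_to_below_right_bound_m
    (R : Type*) [CommRing R] (n : ℕ) (hn : 0 < n)
    (i j : ℕ) (hi1 : 1 ≤ i) (hin : i ≤ n) (hj1 : 1 ≤ j) (hjn : j ≤ n)
    (m : ℕ) (hm : 2 * m ≥ n - j + 2) :
    (t R n i * t R n j - t R n j * t R n i) ^ m = 0 := by
  rcases le_total i j with hij | hji
  · exact commutator_pow_eq_zero R hij hj1 hjn hm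
  · rw [← neg_sub, neg_pow, commutator_pow_eq_zero R hji hi1 hin (by omega), mul_zero]
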